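/- arXiv:2510.16488 — 2 statements merged into one kernel-verified Lean document; each statement's English description precedes it below -/
import Mathlib

section
/- Let n ≥ 2 and let β₁,…,βₙ > 0 satisfy Σᵢ βᵢ² = 1. Then (Πᵢ βᵢ)·(Σᵢ 1/βᵢ) ≤ n^{(3−n)/2}, with equality if and only if β₁ = ⋯ = βₙ = 1/√n. -/
lemma tangent_aux (u w : ℝ) (hu : 0 ≤ u) (hw : 0 ≤ w) (k : ℕ) :
    ((k : ℝ) + 1) * u ^ k * w ≤ w ^ (k + 1) + k * u ^ (k + 1) := by
  induction k with
  | zero => simp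
  | succ k ih =>
    have h1 := mul_le_mul_of_nonneg_right ih hw
    have h2 : 0 ≤ ((k : ℝ) + 1) * u ^ k * (w - u) ^ 2 := by positivity
    push_cast
    have e : w ^ (k + 1 + 1) + ((k : ℝ) + 1) * u ^ (k + 1 + 1)
        - ((k : ℝ) + 1 + 1) * u ^ (k + 1) * w
        = ((w ^ (k + 1) + k * u ^ (k + 1)) * w - ((k : ℝ) + 1) * u ^ k * w * w)
          + ((k : ℝ) + 1) * u ^ k * (w - u) ^ 2 := by ring
    linarith

lemma maclaurin_aux (k : ℕ) : ∀ (a : Fin (k + 1) → ℝ), (∀ i, 0 < a i) →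
    ∏ i, a i ≤ ((∑ i, a i) / ((k : ℝ) + 1)) ^ (k + 1) ∧
    (∏ i, a i) * (∑ i, 1 / a i) ≤ ((k : ℝ) + 1) * ((∑ i, a i) / ((k : ℝ) + 1)) ^ k := by
  induction k with
  | zero =>
    intro a ha
    have := (ha 0).ne'
    simp [this]
  | succ k ih =>
    intro a ha
    obtain ⟨h1, h2⟩ := ih (fun i => a i.succ) (fun i => ha _)
    have hS : 0 ≤ ∑ i : Fin (k + 1), a i.succ := Finset.sum_nonneg fun i _ => (ha _).le
    rw [Fin.prod_univ_succ, Fin.sum_univ_succ a, Fin.sum_univ_succ (fun i => 1 / a i)]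
    have ht := ha 0
    have hk : (0 : ℝ) < (k : ℝ) + 1 := by positivity
    generalize a 0 = t at *
    generalize (∏ i : Fin (k + 1), a i.succ) = P at *
    generalize (∑ i : Fin (k + 1), 1 / a i.succ) = R at *
    obtain ⟨u, hu⟩ : ∃ u, u = (∑ i : Fin (k + 1), a i.succ) / ((k : ℝ) + 1) := ⟨_, rfl⟩
    have hu0 : 0 ≤ u := by rw [hu]; positivity
    rw [← hu] at h1 h2
    have hSu : (∑ i : Fin (k + 1), a i.succ) = ((k : ℝ) + 1) * u := by rw [hu]; field_simp
    rw [hSu]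
    push_cast
    obtain ⟨w, hw⟩ : ∃ w, w = (t + ((k : ℝ) + 1) * u) / ((k : ℝ) + 1 + 1) := ⟨_, rfl⟩
    have hw0 : 0 ≤ w := by rw [hw]; positivity
    have hwt : t = ((k : ℝ) + 1 + 1) * w - ((k : ℝ) + 1) * u := by rw [hw]; field_simp; ring
    rw [← hw]
    constructor
    · have h3 := tangent_aux u w hu0 hw0 (k + 1)
      push_cast at h3
      calc t * P ≤ t * u ^ (k + 1) := by gcongr
        _ = ((k : ℝ) + 1 + 1) * u ^ (k + 1) * w - ((k : ℝ) + 1) * u ^ (k + 1 + 1) := by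
          rw [hwt]; ring
        _ ≤ _ := by linarith
    · have h3 := tangent_aux u w hu0 hw0 k
      have h4 := mul_le_mul_of_nonneg_left h3 (by positivity : (0 : ℝ) ≤ (k : ℝ) + 1 + 1)
      calc t * P * (1 / t + R) = P + t * (P * R) := by field_simp
        _ ≤ u ^ (k + 1) + t * (((k : ℝ) + 1) * u ^ k) := by gcongr
        _ = ((k : ℝ) + 1 + 1) * (((k : ℝ) + 1) * u ^ k * w)
            - ((k : ℝ) + 1 + 1) * (k * u ^ (k + 1)) := by rw [hwt]; ring
        _ ≤ _ := by linarith

theorem beta_ineq_with_equality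
    (n : ℕ) (hn : 2 ≤ n) (β : Fin n → ℝ) (hβ : ∀ i, 0 < β i)
    (hsum : ∑ i, β i ^ 2 = 1) :
    (∏ i, β i) * (∑ i, 1 / β i) ≤ (n : ℝ) ^ ((3 - (n : ℝ)) / 2) ∧
      ((∏ i, β i) * (∑ i, 1 / β i) = (n : ℝ) ^ ((3 - (n : ℝ)) / 2) ↔
        ∀ i, β i = 1 / Real.sqrt n) := by
  obtain ⟨k, rfl⟩ : ∃ k, n = k + 1 := ⟨n - 1, by omega⟩
  have hk : k ≠ 0 := by omega
  have hM := (maclaurin_aux k β hβ).2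
  have hN : (0 : ℝ) < ((k + 1 : ℕ) : ℝ) := by positivity
  have hc : ((k : ℝ) + 1) = ((k + 1 : ℕ) : ℝ) := by push_cast; rfl
  have hkc : (k : ℝ) = ((k + 1 : ℕ) : ℝ) - 1 := by push_cast; ring
  rw [hc] at hM
  have hs : 0 < Real.sqrt ((k + 1 : ℕ) : ℝ) := Real.sqrt_pos.2 hN
  have hss : Real.sqrt ((k + 1 : ℕ) : ℝ) ^ 2 = ((k + 1 : ℕ) : ℝ) := Real.sq_sqrt hN.le
  have hR : (((k + 1 : ℕ) : ℝ)) ^ ((3 - ((k + 1 : ℕ) : ℝ)) / 2)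
      = ((k + 1 : ℕ) : ℝ) * (1 / Real.sqrt ((k + 1 : ℕ) : ℝ)) ^ k := by
    rw [one_div, Real.sqrt_eq_rpow, ← Real.rpow_neg hN.le, ← Real.rpow_natCast,
      ← Real.rpow_mul hN.le]
    nth_rewrite 3 [← Real.rpow_one ((k + 1 : ℕ) : ℝ)]
    rw [← Real.rpow_add hN]
    congr 1
    push_cast
    ring
  rw [hR]
  have hcard : ∑ i : Fin (k + 1), (β i - 1 / Real.sqrt ((k + 1 : ℕ) : ℝ)) ^ 2
      = 2 - 2 * (1 / Real.sqrt ((k + 1 : ℕ) : ℝ)) * ∑ i, β i := by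
    have : ∀ i, (β i - 1 / Real.sqrt ((k + 1 : ℕ) : ℝ)) ^ 2
        = β i ^ 2 - 2 * (1 / Real.sqrt ((k + 1 : ℕ) : ℝ)) * β i
          + 1 / ((k + 1 : ℕ) : ℝ) := by
      intro i
      rw [sub_sq, div_pow, hss]; ring
    simp_rw [this]
    rw [Finset.sum_add_distrib, Finset.sum_sub_distrib, hsum, ← Finset.mul_sum,
      Finset.sum_const, Finset.card_univ, Fintype.card_fin, nsmul_eq_mul,
      mul_one_div_cancel hN.ne']
    ring
  have hnn : 0 ≤ ∑ i : Fin (k + 1), (β i - 1 / Real.sqrt ((k + 1 : ℕ) : ℝ)) ^ 2 :=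
    Finset.sum_nonneg fun i _ => sq_nonneg _
  have hS0 : 0 ≤ ∑ i, β i := Finset.sum_nonneg fun i _ => (hβ i).le
  clear hR hc hkc
  generalize ((k + 1 : ℕ) : ℝ) = N at *
  generalize hr : Real.sqrt N = r at *
  have hSr : ∑ i, β i ≤ r := by
    rw [hcard] at hnn
    have : 1 / r * ∑ i, β i ≤ 1 := by linarith
    rwa [one_div, inv_mul_le_iff₀ hs, mul_one] at this
  have hle : (∑ i, β i) / N ≤ 1 / r := by
    rw [div_le_div_iff₀ hN hs, ← hss]; nlinarith
  have hpow : N * ((∑ i, β i) / N) ^ k ≤ N * (1 / r) ^ k := by gcongr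
  refine ⟨hM.trans hpow, ?_, ?_⟩
  · intro h
    have h1 : (1 / r) ^ k ≤ ((∑ i, β i) / N) ^ k := by
      rw [h] at hM
      exact le_of_mul_le_mul_left hM hN
    have h2 : 1 / r ≤ (∑ i, β i) / N :=
      le_of_pow_le_pow_left₀ hk (by positivity) h1
    have h3 : r ≤ ∑ i, β i := by
      rw [div_le_div_iff₀ hs hN, ← hss] at h2
      nlinarith
    have h4 : ∑ i, β i = r := le_antisymm hSr h3
    have h5 : ∑ i : Fin (k + 1), (β i - 1 / r) ^ 2 = 0 := by
      rw [hcard, h4]; field_simp; ring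
    intro i
    have h6 := (Finset.sum_eq_zero_iff_of_nonneg (fun i _ => sq_nonneg _)).1 h5 i
      (Finset.mem_univ i)
    exact sub_eq_zero.1 (pow_eq_zero_iff (two_ne_zero) |>.1 h6)
  · intro h
    have hN2 : N = (k : ℝ) + 1 := by
      have : ∑ i : Fin (k + 1), β i ^ 2 = ((k : ℝ) + 1) * (1 / r) ^ 2 := by
        simp [h]
      rw [hsum, div_pow, hss] at this
      field_simp at this
      linarith
    simp only [h, Finset.prod_const, Finset.sum_const, Finset.card_univ, Fintype.card_fin,
      nsmul_eq_mul, one_div_one_div]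
    push_cast
    rw [← hN2, pow_succ]
    field_simp
end

section
/- Let n ≥ 2 and let β₁,…,βₙ > 0 satisfy Σᵢ βᵢ² = 1. Then (Πᵢ βᵢ)·√(Σᵢ 1/βᵢ²) ≤ n^{(2−n)/2}. -/
theorem aux_bern (m : ℕ) (A t : ℝ) (hA : 0 ≤ A) (ht : 0 ≤ t) :
    t ^ m * ((m + 1) * A - m * t) ≤ A ^ (m + 1) := by
  induction m with
  | zero => simp
  | succ m ih =>
    have h1 := mul_le_mul_of_nonneg_left ih hA
    have h2 : 0 ≤ t ^ m * ((m + 1) * (A - t) ^ 2) := by positivity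
    have h3 : A ^ (m + 1 + 1) = A * A ^ (m + 1) := by ring
    rw [h3]
    refine le_trans ?_ h1
    push_cast
    rw [pow_succ]
    nlinarith

theorem aux_main (m : ℕ) (a : Fin (m + 1) → ℝ) (ha : ∀ i, 0 < a i) :
    ∏ i, a i ≤ ((∑ i, a i) / (m + 1)) ^ (m + 1) ∧
    (∏ i, a i) * ∑ i, 1 / a i ≤ (m + 1) * ((∑ i, a i) / (m + 1)) ^ m := by
  induction m with
  | zero =>
    have := (ha 0).ne'
    simp [this]
  | succ m ih =>
    obtain ⟨h1, h2⟩ := ih (fun i => a i.succ) (fun i => ha _)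
    rw [Fin.prod_univ_succ, Fin.sum_univ_succ, Fin.sum_univ_succ (fun i => 1 / a i)]
    have hx := ha 0
    have hS : 0 ≤ ∑ i : Fin (m + 1), a i.succ := Finset.sum_nonneg fun i _ => (ha _).le
    set x := a 0
    set p := ∏ i : Fin (m + 1), a i.succ
    set S := ∑ i : Fin (m + 1), a i.succ
    set R := ∑ i : Fin (m + 1), 1 / a i.succ
    obtain ⟨t, ht⟩ : ∃ t, t = S / ((m : ℝ) + 1) := ⟨_, rfl⟩
    have hSt : S = (m + 1) * t := by rw [ht]; field_simp
    have ht0 : 0 ≤ t := by rw [ht]; positivity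
    rw [← ht] at h1 h2
    obtain ⟨A, hA⟩ : ∃ A, A = (x + S) / (((m + 1 : ℕ) : ℝ) + 1) := ⟨_, rfl⟩
    rw [← hA]
    have hA0 : 0 ≤ A := by rw [hA]; positivity
    have hxA : x = (m + 2) * A - (m + 1) * t := by
      rw [hA, hSt]; push_cast; field_simp; ring
    constructor
    · have := aux_bern (m + 1) A t hA0 ht0
      push_cast at this
      have e : ((m : ℝ) + 1 + 1) * A - (m + 1) * t = x := by rw [hxA]; ring
      rw [e] at this
      nlinarith
    · have hb := aux_bern m A t hA0 ht0
      have e : x * p * (1 / x + R) = p + x * (p * R) := by field_simp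
      rw [e]
      have h3 := mul_le_mul_of_nonneg_left h2 hx.le
      have h4 : ((m : ℝ) + 2) * (t ^ m * ((m + 1) * A - m * t)) ≤ (m + 2) * A ^ (m + 1) :=
        mul_le_mul_of_nonneg_left hb (by positivity)
      have h5 : ((m : ℝ) + 2) * (t ^ m * ((m + 1) * A - m * t))
          = t ^ (m + 1) + x * ((m + 1) * t ^ m) := by
        rw [hxA]; ring
      push_cast
      linarith

theorem beta_prod_sqrt_sum_ineq
    (n : ℕ) (hn : 2 ≤ n) (β : Fin n → ℝ) (hβ : ∀ i, 0 < β i)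
    (hsum : ∑ i, β i ^ 2 = 1) :
    (∏ i, β i) * Real.sqrt (∑ i, 1 / β i ^ 2) ≤ (n : ℝ) ^ ((2 - (n : ℝ)) / 2) := by
  obtain ⟨m, rfl⟩ : ∃ m, n = m + 1 := ⟨n - 1, by omega⟩
  have h := (aux_main m (fun i => β i ^ 2) (fun i => pow_pos (hβ i) 2)).2
  rw [hsum, Finset.prod_pow] at h
  have hR : 0 ≤ ∑ i, 1 / β i ^ 2 := Finset.sum_nonneg fun i _ => by positivity
  have hN : (0 : ℝ) < (m : ℝ) + 1 := by positivity
  refine (sq_le_sq₀ (mul_nonneg (Finset.prod_nonneg fun i _ => (hβ i).le) (Real.sqrt_nonneg _)) (by positivity)).1 ?_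
  rw [mul_pow, Real.sq_sqrt hR]
  refine h.trans (le_of_eq ?_)
  rw [← Real.rpow_natCast (_ ^ _) 2, ← Real.rpow_mul (by positivity)]
  push_cast
  have e : (2 - ((m : ℝ) + 1)) / 2 * 2 = 1 - m := by ring
  rw [e, Real.rpow_sub hN, Real.rpow_one, Real.rpow_natCast, one_div, inv_pow, div_eq_mul_inv]
end
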